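/- For all real numbers a > 1, b ∈ (0, a) and c ∈ (-1, 0), there exists a C^∞ function φ : ℝ → ℝ such that: (b1) φ(x) = c·x for all x ∈ [-b, b]; (b2) φ(a) = φ(-a) = 0 and φ'(a) = φ'(-a) = 0; (b3) c ≤ φ'(x) < 2·(b/(a-b))·|c| for all x ∈ [-a, a], and φ'(x) = c if and only if x ∈ [-b, b]; (b4) |φ(x)| < 2·b·|c| for all x ∈ [-a, a]. -/

import Mathlib

open intervalIntegral in
lemma integral_le_of_le_of_le_split {f : ℝ → ℝ} (hf : Continuous f) {u w v C D : ℝ}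
    (huw : u ≤ w) (hwv : w ≤ v) (hC : ∀ x ∈ Set.Icc u w, f x ≤ C)
    (hD : ∀ x ∈ Set.Icc w v, f x ≤ D) :
    ∫ x in u..v, f x ≤ C * (w - u) + D * (v - w) := by
  have h1 : ∫ x in u..w, f x ≤ ∫ _ in u..w, C :=
    integral_mono_on huw (hf.intervalIntegrable _ _) (by simp) hC
  have h2 : ∫ x in w..v, f x ≤ ∫ _ in w..v, D :=
    integral_mono_on hwv (hf.intervalIntegrable _ _) (by simp) hD
  rw [← integral_add_adjacent_intervals (hf.intervalIntegrable u w) (hf.intervalIntegrable w v)]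
  simp only [integral_const, smul_eq_mul] at h1 h2
  linarith

lemma integral_zero_neg_of_even {g : ℝ → ℝ} (hg : ∀ x, g (-x) = g x) (x : ℝ) :
    ∫ t in (0 : ℝ)..(-x), g t = -∫ t in (0 : ℝ)..x, g t := by
  have h := intervalIntegral.integral_comp_neg (a := 0) (b := x) g
  simp only [hg, neg_zero] at h
  rw [h, intervalIntegral.integral_symm]

lemma contDiff_integral_of_contDiff {g : ℝ → ℝ} (hg : ContDiff ℝ (⊤ : ℕ∞) g) :
    ContDiff ℝ (⊤ : ℕ∞) fun x => ∫ t in (0 : ℝ)..x, g t := by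
  have h : ∀ x, HasDerivAt (fun x => ∫ t in (0 : ℝ)..x, g t) (g x) x := fun x =>
    hg.continuous.integral_hasStrictDerivAt 0 x |>.hasDerivAt
  rw [contDiff_infty_iff_deriv]
  refine ⟨fun x => (h x).differentiableAt, ?_⟩
  rwa [funext fun x => (h x).deriv]

/-- Smooth even cut-offs `S`, vanishing exactly on `[-b, b]`, and `T`, vanishing at `±a`, both
equal to `1` on most of `[b, a]`. -/
lemma exists_even_cutoffs {a b ε : ℝ} (hb : 0 < b) (hba : b < a) (hε : 0 < ε) (hεa : ε ≤ a - b) :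
    ∃ S T : ℝ → ℝ, ContDiff ℝ (⊤ : ℕ∞) S ∧ ContDiff ℝ (⊤ : ℕ∞) T ∧
      (∀ x, S (-x) = S x) ∧ (∀ x, T (-x) = T x) ∧
      (∀ x, 0 ≤ S x ∧ S x ≤ 1) ∧ (∀ x, 0 ≤ T x ∧ T x ≤ 1) ∧
      (∀ x, S x = 0 ↔ x ∈ Set.Icc (-b) b) ∧ S a = 1 ∧ T a = 0 ∧
      (∫ x in b..a, (1 - S x)) ≤ ε ∧ (∫ x in b..a, (1 - T x)) ≤ ε := by
  have hδ : 0 < 2 * b * ε := by positivity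
  have hS : ContDiff ℝ (⊤ : ℕ∞) fun x : ℝ =>
      Real.smoothTransition ((x ^ 2 - b ^ 2) / (2 * b * ε)) :=
    Real.smoothTransition.contDiff.comp (by fun_prop)
  have hT : ContDiff ℝ (⊤ : ℕ∞) fun x : ℝ =>
      Real.smoothTransition ((a ^ 2 - x ^ 2) / (2 * b * ε)) :=
    Real.smoothTransition.contDiff.comp (by fun_prop)
  have hS1 : ∀ x, b + ε ≤ x → Real.smoothTransition ((x ^ 2 - b ^ 2) / (2 * b * ε)) = 1 := by
    intro x hx
    apply Real.smoothTransition.one_of_one_le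
    rw [one_le_div hδ]
    nlinarith
  have hT1 : ∀ x, b ≤ x → x ≤ a - ε →
      Real.smoothTransition ((a ^ 2 - x ^ 2) / (2 * b * ε)) = 1 := by
    intro x hx hx'
    apply Real.smoothTransition.one_of_one_le
    rw [one_le_div hδ]
    nlinarith
  refine ⟨_, _, hS, hT, by simp, by simp,
    fun x => ⟨Real.smoothTransition.nonneg _, Real.smoothTransition.le_one _⟩,
    fun x => ⟨Real.smoothTransition.nonneg _, Real.smoothTransition.le_one _⟩,
    fun x => ?_, hS1 a (by linarith), by simp, ?_, ?_⟩
  · rw [Real.smoothTransition.zero_iff_nonpos, div_le_iff₀ hδ, zero_mul, sub_nonpos,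
      sq_le_sq, abs_of_pos hb, abs_le, Set.mem_Icc]
  · refine (integral_le_of_le_of_le_split (w := b + ε) (C := 1) (D := 0)
      (by have := hS.continuous; fun_prop) (by linarith) (by linarith) (fun x _ => ?_)
      fun x hx => ?_).trans (by linarith)
    · linarith [Real.smoothTransition.nonneg ((x ^ 2 - b ^ 2) / (2 * b * ε))]
    · rw [hS1 x hx.1]; simp
  · refine (integral_le_of_le_of_le_split (w := a - ε) (C := 0) (D := 1)
      (by have := hT.continuous; fun_prop) (by linarith) (by linarith) (fun x hx => ?_)
      fun x _ => ?_).trans (by linarith)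
    · rw [hT1 x hx.1 hx.2]; simp
    · linarith [Real.smoothTransition.nonneg ((a ^ 2 - x ^ 2) / (2 * b * ε))]


/-- Lemma 7.2: for `a > 1`, `b ∈ (0,a)`, `c ∈ (-1,0)` there is a smooth `φ : ℝ → ℝ` with
(b1) `φ(x) = c·x` on `[-b, b]`;
(b2) `φ(±a) = 0` and `φ'(±a) = 0`;
(b3) `c ≤ φ'(x) < 2·(b/(a-b))·|c|` on `[-a, a]`, with `φ'(x) = c` iff `x ∈ [-b, b]`;
(b4) `|φ(x)| < 2·b·|c|` on `[-a, a]`. -/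
theorem exists_phi (a b c : ℝ) (ha : 1 < a) (hb : b ∈ Set.Ioo 0 a) (hc : c ∈ Set.Ioo (-1 : ℝ) 0) :
    ∃ φ : ℝ → ℝ, ContDiff ℝ (⊤ : ℕ∞) φ ∧
      (∀ x ∈ Set.Icc (-b) b, φ x = c * x) ∧
      (φ a = 0 ∧ φ (-a) = 0 ∧ deriv φ a = 0 ∧ deriv φ (-a) = 0) ∧
      (∀ x ∈ Set.Icc (-a) a, c ≤ deriv φ x ∧ deriv φ x < 2 * (b / (a - b)) * |c|) ∧
      (∀ x ∈ Set.Icc (-a) a, (deriv φ x = c ↔ x ∈ Set.Icc (-b) b)) ∧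
      (∀ x ∈ Set.Icc (-a) a, |φ x| < 2 * b * |c|) := by
  obtain ⟨hb0, hba⟩ := hb
  obtain ⟨-, hc0⟩ := hc
  have hL : 0 < a - b := sub_pos.2 hba
  obtain ⟨ε, hε, hεL⟩ : ∃ ε, 0 < ε ∧ ε * (a - b + 4 * b) < b * (a - b) := by
    refine ⟨b * (a - b) / (2 * (a - b + 4 * b)), by positivity, ?_⟩
    have : 0 < b * (a - b) := by positivity
    have h4 : 0 < a - b + 4 * b := by linarith
    rw [div_mul_eq_mul_div, div_lt_iff₀ (by positivity)]
    nlinarith [mul_pos this h4]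
  have hεb : ε < b := by
    by_contra! h
    nlinarith
  have hε4 : 4 * ε < a - b := by
    by_contra! h
    nlinarith
  obtain ⟨S, T, hS, hT, hSe, hTe, hS01, hT01, hS0, hSa, hTa, hSi, hTi⟩ :=
    exists_even_cutoffs hb0 hba hε (by linarith)
  have hSc := hS.continuous
  have hTc := hT.continuous
  have hint : ∀ {f : ℝ → ℝ}, Continuous f → ∀ u v, IntervalIntegrable f MeasureTheory.volume u v :=
    fun hf u v => hf.intervalIntegrable u v
  set I := ∫ x in b..a, (1 - S x) with hI
  set J := ∫ x in b..a, S x * T x with hJ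
  have hI0 : 0 ≤ I := intervalIntegral.integral_nonneg hba.le fun x _ => by linarith [hS01 x]
  have hJL : a - b - 2 * ε ≤ J := by
    have h : ∫ x in b..a, (1 - (1 - S x) - (1 - T x)) ≤ J := by
      refine intervalIntegral.integral_mono_on hba.le (hint (by fun_prop) _ _)
        (hint (by fun_prop) _ _) fun x _ => ?_
      nlinarith [hS01 x, hT01 x]
    rw [intervalIntegral.integral_sub (hint (by fun_prop) _ _) (hint (by fun_prop) _ _),
      intervalIntegral.integral_sub (hint (by fun_prop) _ _) (hint (by fun_prop) _ _)] at h
    simp only [intervalIntegral.integral_const, smul_eq_mul, mul_one] at h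
    linarith
  have hJ0 : 0 < J := by linarith
  obtain ⟨M, hM⟩ : ∃ M, M = -c * (b + I) / J := ⟨_, rfl⟩
  have hMJ : M * J = -c * (b + I) := by rw [hM]; field_simp
  have hM0 : 0 < M := by rw [hM]; exact div_pos (by nlinarith) hJ0
  have hMlt : M < 2 * (b / (a - b)) * |c| := by
    rw [abs_of_neg hc0, hM, show 2 * (b / (a - b)) * -c = -c * (2 * b) / (a - b) by ring,
      div_lt_div_iff₀ hJ0 hL, mul_assoc, mul_assoc]
    refine mul_lt_mul_of_pos_left ?_ (by linarith)
    nlinarith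
  let g : ℝ → ℝ := fun x => c * (1 - S x) + M * (S x * T x)
  have hg : ContDiff ℝ (⊤ : ℕ∞) g := by fun_prop
  have hgc := hg.continuous
  have hge : ∀ x, g (-x) = g x := fun x => by simp only [g, hSe, hTe]
  have hgS : ∀ x, c * (1 - S x) ≤ g x := fun x => by
    have := mul_nonneg hM0.le (mul_nonneg (hS01 x).1 (hT01 x).1)
    simp only [g]; linarith
  have hgb : ∀ x ∈ Set.Icc (-b) b, g x = c := fun x hx => by simp [g, (hS0 x).2 hx]
  have hga : g a = 0 := by simp [g, hSa, hTa]
  have hderiv : deriv (fun x => ∫ t in (0 : ℝ)..x, g t) = g :=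
    funext fun x => (hgc.integral_hasStrictDerivAt 0 x).hasDerivAt.deriv
  have hφb : ∀ x ∈ Set.Icc (-b) b, ∫ t in (0 : ℝ)..x, g t = c * x := fun x hx => by
    rw [intervalIntegral.integral_congr (g := fun _ => c) fun t ht =>
      hgb t (Set.uIcc_subset_Icc ⟨by linarith, hb0.le⟩ hx ht)]
    simp [mul_comm]
  have hsplit : ∀ u v, (∫ t in (0 : ℝ)..v, g t) = (∫ t in (0 : ℝ)..u, g t) + ∫ t in u..v, g t :=
    fun u v => (intervalIntegral.integral_add_adjacent_intervals (hint hgc _ _)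
      (hint hgc _ _)).symm
  have hφa : ∫ t in (0 : ℝ)..a, g t = 0 := by
    rw [hsplit b a, hφb b ⟨by linarith, le_rfl⟩]
    simp only [g]
    rw [intervalIntegral.integral_add (hint (by fun_prop) _ _) (hint (by fun_prop) _ _),
      intervalIntegral.integral_const_mul, intervalIntegral.integral_const_mul, ← hI, ← hJ, hMJ]
    ring
  have hlow : ∀ u v, b ≤ u → u ≤ v → v ≤ a → c * ε ≤ ∫ t in u..v, g t := by
    intro u v hu huv hv
    have h1 : ∫ t in u..v, c * (1 - S t) ≤ ∫ t in u..v, g t :=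
      intervalIntegral.integral_mono_on huv (hint (by fun_prop) _ _) (hint hgc _ _)
        fun x _ => hgS x
    have h2 : ∫ t in u..v, (1 - S t) ≤ I :=
      intervalIntegral.integral_mono_interval hu huv hv
        (Filter.Eventually.of_forall fun x => by simpa using (hS01 x).2) (hint (by fun_prop) _ _)
    rw [intervalIntegral.integral_const_mul] at h1
    nlinarith
  have habs : ∀ x, 0 ≤ x → x ≤ a → |∫ t in (0 : ℝ)..x, g t| < 2 * b * |c| := by
    intro x hx hxa
    rw [abs_of_neg hc0, abs_lt]
    rcases le_total x b with hxb | hxb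
    · rw [hφb x ⟨by linarith, hxb⟩]
      constructor <;> nlinarith
    · have h1 := hlow b x le_rfl hxb hxa
      have h2 := hlow x a hxb hxa le_rfl
      have h3 := hsplit b x
      have h4 := hsplit x a
      rw [hφb b ⟨by linarith, le_rfl⟩] at h3
      constructor <;> nlinarith
  refine ⟨fun x => ∫ t in (0 : ℝ)..x, g t, contDiff_integral_of_contDiff hg, hφb,
    ⟨hφa, ?_, ?_, ?_⟩, fun x _ => ?_, fun x _ => ?_, fun x hx => ?_⟩
  · simp only [integral_zero_neg_of_even hge, hφa, neg_zero]
  · rw [hderiv, hga]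
  · rw [hderiv, hge, hga]
  · rw [hderiv]
    refine ⟨by nlinarith [hgS x, hS01 x], lt_of_le_of_lt ?_ hMlt⟩
    have h1 : S x * T x ≤ 1 := mul_le_one₀ (hS01 x).2 (hT01 x).1 (hT01 x).2
    simp only [g]
    nlinarith [hS01 x]
  · rw [hderiv]
    refine ⟨fun h => (hS0 x).1 ?_, hgb x⟩
    by_contra hne
    have := (hS01 x).1.lt_of_ne' hne
    nlinarith [hgS x]
  · rcases le_total 0 x with h | h
    · exact habs x h hx.2
    · have := habs (-x) (by linarith) (by linarith [hx.1])
      rwa [integral_zero_neg_of_even hge, abs_neg] at this
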